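/- arXiv:1903.01783 — 3 statements merged into one kernel-verified Lean document; each statement's English description precedes it below -/
import Mathlib

section
/- (Tate) Let A be a commutative ring and B an A-algebra, let f₁, …, f_n be a regular sequence in B such that C := B/(f₁, …, f_n) is a finite free A-module, with quotient map π : B → C. Let s : B ⊗_A C → C be the A-algebra map b⊗c ↦ π(b)·c and assume its kernel J is generated by a (B ⊗_A C)-regular sequence g₁, …, g_n. Choose h_{ij} ∈ B ⊗_A C with f_i ⊗ 1 = Σ_j h_{ij} g_j, set Δ = det(h_{ij}) ∈ B ⊗_A C, and let Δ̄ = (π ⊗ 1_C)(Δ) ∈ C ⊗_A C. Then the map t : Hom_A(C, A) → C, t(φ) = (1_C ⊗ φ)(Δ̄) (where 1_C ⊗ φ : C ⊗_A C → C applies φ to the second tensor factor), is an isomorphism of C-modules. -/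
open scoped TensorProduct

open CliffordAlgebra in
/-- Contracting successively with the forms in a list, then projecting to degree zero. -/
noncomputable def ExteriorAlgebra.iteratedContraction {R M : Type*} [CommRing R] [AddCommGroup M]
    [Module R M] : List (Module.Dual R M) → ExteriorAlgebra R M →ₗ[R] R
  | [] => ExteriorAlgebra.algebraMapInv.toLinearMap
  | d :: l => (iteratedContraction l).comp (contractLeft (Q := 0) d)

namespace ExteriorAlgebra

open CliffordAlgebra (contractLeft)

section Contraction

variable {R M : Type*} [CommRing R] [AddCommGroup M] [Module R M]

instance [Module.Free R M] : Module.Free R (ExteriorAlgebra R M) :=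
  Module.Free.of_equiv (DirectSum.decomposeLinearEquiv (fun i : ℕ ↦ ⋀[R]^i M)).symm

theorem iteratedContraction_contractLeft_of_mem {l : List (Module.Dual R M)}
    {d : Module.Dual R M} (hd : d ∈ l) (x : ExteriorAlgebra R M) :
    iteratedContraction l (contractLeft (Q := 0) d x) = 0 := by
  induction l generalizing x with
  | nil => simp at hd
  | cons d' l ih =>
    rcases List.mem_cons.1 hd with rfl | hd
    · simp [iteratedContraction, CliffordAlgebra.contractLeft_contractLeft]
    · simp only [iteratedContraction, LinearMap.comp_apply]
      rw [CliffordAlgebra.contractLeft_comm, map_neg, ih hd, neg_zero]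

theorem contractLeft_ι_mul (d : Module.Dual R M) (m : M) (x : ExteriorAlgebra R M) :
    contractLeft (Q := 0) d (ι R m * x) = d m • x - ι R m * contractLeft (Q := 0) d x :=
  CliffordAlgebra.contractLeft_ι_mul d m x

theorem contractLeft_algebraMap (d : Module.Dual R M) (r : R) :
    contractLeft (Q := 0) d (algebraMap R (ExteriorAlgebra R M) r) = 0 :=
  CliffordAlgebra.contractLeft_algebraMap 0 d r

@[elab_as_elim]
theorem left_induction {P : ExteriorAlgebra R M → Prop}
    (algebraMap : ∀ r, P (algebraMap R (ExteriorAlgebra R M) r))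
    (add : ∀ x y, P x → P y → P (x + y)) (ι_mul : ∀ x m, P x → P (ι R m * x))
    (x : ExteriorAlgebra R M) : P x :=
  CliffordAlgebra.left_induction (Q := 0) algebraMap add ι_mul x

theorem contractLeft_prod_ι_eq_zero (d : Module.Dual R M) (l : List M) (hl : ∀ m ∈ l, d m = 0) :
    contractLeft (Q := 0) d ((l.map (ι R)).prod) = 0 := by
  induction l with
  | nil => simp
  | cons m l ih =>
    rw [List.map_cons, List.prod_cons, contractLeft_ι_mul, ih fun m' hm' ↦ hl m' (List.mem_cons_of_mem _ hm'), hl m List.mem_cons_self]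
    simp

theorem iteratedContraction_coord_prod_ι {κ : Type*} [DecidableEq κ] (b : Module.Basis κ R M)
    {l : List κ} (hl : l.Nodup) :
    iteratedContraction (l.map b.coord) (((l.map b).map (ι R)).prod) = 1 := by
  induction l with
  | nil => simp [iteratedContraction]
  | cons j l ih =>
    rw [List.nodup_cons] at hl
    simp only [List.map_cons, List.prod_cons, iteratedContraction, LinearMap.comp_apply]
    rw [contractLeft_ι_mul, contractLeft_prod_ι_eq_zero]
    · simpa using ih hl.2
    · intro m hm
      obtain ⟨k, hk, rfl⟩ := List.mem_map.1 hm
      have : k ≠ j := by rintro rfl; exact hl.1 hk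
      simp [this]

/-- Every element in the image of the Koszul differential of `f` has coefficients in `(f)`. -/
theorem contractLeft_sum_mem {κ : Type*} [Fintype κ] (f : κ → R) (d : κ → Module.Dual R M)
    (φ : ExteriorAlgebra R M →ₗ[R] R) (x : ExteriorAlgebra R M) :
    φ (contractLeft (Q := 0) (∑ j, f j • d j) x) ∈ Ideal.span (Set.range f) := by
  simp only [map_sum, map_smul, LinearMap.sum_apply, LinearMap.smul_apply, smul_eq_mul]
  exact Ideal.sum_mem _ fun j _ ↦ Ideal.mul_mem_right _ _ (Ideal.subset_span ⟨j, rfl⟩)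

end Contraction

section SemilinearMap

variable {B S M N : Type*} [CommRing B] [CommRing S] [Algebra B S] [AddCommGroup M] [Module B M]
  [AddCommGroup N] [Module S N] [Module B N] [IsScalarTower B S N]

/-- The map of exterior algebras induced by a linear map along a ring extension. -/
noncomputable def mapRestrictScalars (u : M →ₗ[B] N) :
    ExteriorAlgebra B M →ₐ[B] ExteriorAlgebra S N :=
  lift B ⟨((ι S).restrictScalars B).comp u, fun m ↦ ι_sq_zero (u m)⟩

theorem mapRestrictScalars_ι (u : M →ₗ[B] N) (m : M) :
    mapRestrictScalars (S := S) u (ι B m) = ι S (u m) :=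
  lift_ι_apply ..

theorem mapRestrictScalars_ιMulti (u : M →ₗ[B] N) {n : ℕ} (v : Fin n → M) :
    mapRestrictScalars (S := S) u (ιMulti B n v) = ιMulti S n (fun i ↦ u (v i)) := by
  simp only [ιMulti_apply, map_list_prod, List.map_ofFn]
  congr! 2
  exact funext fun i ↦ mapRestrictScalars_ι u (v i)

theorem algebraMapInv_mapRestrictScalars (u : M →ₗ[B] N) (x : ExteriorAlgebra B M) :
    algebraMapInv (mapRestrictScalars (S := S) u x) = algebraMap B S (algebraMapInv x) := by
  suffices ((algebraMapInv (R := S) (M := N)).restrictScalars B).comp (mapRestrictScalars u) =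
      (Algebra.ofId B S).comp algebraMapInv from DFunLike.congr_fun this x
  ext m
  simp [mapRestrictScalars_ι, algebraMapInv]

theorem mapRestrictScalars_contractLeft (u : M →ₗ[B] N) {d : Module.Dual B M}
    {d' : Module.Dual S N} (hd : ∀ m, d' (u m) = algebraMap B S (d m)) (x : ExteriorAlgebra B M) :
    mapRestrictScalars (S := S) u (contractLeft (Q := 0) d x) =
      contractLeft (Q := 0) d' (mapRestrictScalars u x) := by
  induction x using left_induction with
  | algebraMap r =>
    rw [contractLeft_algebraMap, map_zero, AlgHom.commutes,
      IsScalarTower.algebraMap_apply B S (ExteriorAlgebra S N), contractLeft_algebraMap]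
  | add x y hx hy => simp only [map_add, hx, hy]
  | ι_mul x m hx =>
    rw [contractLeft_ι_mul, map_sub, map_smul, map_mul, map_mul, hx, mapRestrictScalars_ι,
      contractLeft_ι_mul, hd, algebraMap_smul]

end SemilinearMap

theorem _root_.AlternatingMap.map_sum_smul_eq_det_smul {R M N κ : Type*} [CommRing R]
    [AddCommGroup M] [Module R M] [AddCommGroup N] [Module R N] [Fintype κ] [DecidableEq κ]
    (φ : M [⋀^κ]→ₗ[R] N) (h : Matrix κ κ R) (v : κ → M) :
    φ (fun i ↦ ∑ j, h i j • v j) = h.det • φ v := by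
  suffices φ.compLinearMap (Fintype.linearCombination R v) =
      (LinearMap.toSpanSingleton R N (φ v)).compAlternatingMap Matrix.detRowAlternating by
    exact DFunLike.congr_fun this h
  refine Module.Basis.ext_alternating (Pi.basisFun R κ) fun σ hσ ↦ ?_
  obtain ⟨σ, rfl⟩ : ∃ τ : Equiv.Perm κ, ⇑τ = σ :=
    ⟨Equiv.ofBijective σ (Finite.injective_iff_bijective.1 hσ), rfl⟩
  have : (fun i ↦ Pi.basisFun R κ (σ i)) = (Pi.basisFun R κ) ∘ σ := rfl
  rw [this, AlternatingMap.map_perm, AlternatingMap.map_perm]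
  congr 1
  have h₁ : Matrix.detRowAlternating (Pi.basisFun R κ) = (1 : R) := by
    rw [← Matrix.det_one (n := κ) (R := R)]
    exact congrArg _ (by ext i j; simp [Matrix.one_apply, Pi.single_apply, eq_comm])
  simp [h₁, Fintype.linearCombination_apply_single]

end ExteriorAlgebra

section Lifting

variable {B E F : Type*} [CommRing B] [AddCommGroup E] [Module B E] [AddCommGroup F] [Module B F]

theorem exists_forall_sub_mul_mem_of_mem_sup [Module.Projective B E] {I : Ideal B} {r : B}
    (φ : E →ₗ[B] B) (hφ : ∀ x, φ x ∈ I ⊔ Ideal.span {r}) :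
    ∃ a : E →ₗ[B] B, ∀ x, φ x - r * a x ∈ I := by
  let q : B →ₗ[B] B ⧸ I := r • I.mkQ
  have hq : ∀ x, (I.mkQ.comp φ) x ∈ LinearMap.range q := fun x ↦ by
    obtain ⟨a, ha, b, hb, hab⟩ := Submodule.mem_sup.1 (hφ x)
    obtain ⟨c, rfl⟩ := Ideal.mem_span_singleton'.1 hb
    refine ⟨c, ?_⟩
    simp only [LinearMap.comp_apply, ← hab, map_add, q, LinearMap.smul_apply]
    rw [(Submodule.Quotient.mk_eq_zero I).2 ha |> fun h ↦ (h : I.mkQ a = 0), zero_add,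
      ← map_smul, smul_eq_mul, mul_comm]
  obtain ⟨a, ha⟩ := Module.projective_lifting_property q.rangeRestrict
    ((I.mkQ.comp φ).codRestrict _ hq) q.surjective_rangeRestrict
  refine ⟨a, fun x ↦ ?_⟩
  have := congrArg Subtype.val (LinearMap.congr_fun ha x)
  exact (Submodule.Quotient.eq I).1 this.symm

/-- Lifting a cocycle modulo `(I, r)` along the connecting homomorphism of
multiplication by `r` on `B ⧸ I`, compatibly with a chain map `α` up to homotopy. -/
theorem exists_cocycle_of_cocycle_sup [Module.Projective B E] [Module.Projective B F]
    {dE : E →ₗ[B] E} (hdE : ∀ x, dE (dE x) = 0) {dF : F →ₗ[B] F} (hdF : ∀ x, dF (dF x) = 0)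
    {α : F →ₗ[B] E} (hα : ∀ x, α (dF x) = dE (α x)) {I : Ideal B} {r : B}
    (hr : ∀ b, r * b ∈ I → b ∈ I) {c c' : F →ₗ[B] B} (hc : ∀ x, c' (dF x) - r * c x ∈ I)
    (hw : ∃ (w : E →ₗ[B] B) (y : F →ₗ[B] B), (∀ x, w (dE x) ∈ I ⊔ Ideal.span {r}) ∧
      ∀ x, w (α x) - c' x - y (dF x) ∈ I ⊔ Ideal.span {r}) :
    ∃ (w : E →ₗ[B] B) (y : F →ₗ[B] B), (∀ x, w (dE x) ∈ I) ∧
      ∀ x, w (α x) - c x - y (dF x) ∈ I := by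
  obtain ⟨w, y, hw, hy⟩ := hw
  obtain ⟨w', hw'⟩ := exists_forall_sub_mul_mem_of_mem_sup (w.comp dE) hw
  obtain ⟨y', hy'⟩ := exists_forall_sub_mul_mem_of_mem_sup (w.comp α - c' - y.comp dF) hy
  refine ⟨w', y', fun x ↦ hr _ ?_, fun x ↦ hr _ ?_⟩
  · simpa [hdE] using hw' (dE x)
  · have h₁ := hw' (α x)
    have h₂ := hy' (dF x)
    simp only [LinearMap.comp_apply, LinearMap.sub_apply, hdF, hα, map_zero, sub_zero] at h₁ h₂
    have := I.add_mem (I.sub_mem h₂ h₁) (hc x)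
    convert this using 1
    ring

end Lifting

section Koszul

open ExteriorAlgebra
open CliffordAlgebra (contractLeft)

variable {B : Type*} [CommRing B] {n : ℕ}

theorem ofList_take_succ_ofFn (f : Fin n → B) {i : ℕ} (hi : i < n) :
    Ideal.ofList ((List.ofFn f).take (i + 1)) =
      Ideal.ofList ((List.ofFn f).take i) ⊔ Ideal.span {f ⟨i, hi⟩} := by
  rw [List.take_add_one, Ideal.ofList_append]
  simp [hi]

theorem ofList_ofFn (f : Fin n → B) : Ideal.ofList (List.ofFn f) = Ideal.span (Set.range f) := by
  simp [Ideal.ofList, List.mem_ofFn', Set.range]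

theorem mem_ofList_take_of_lt (f : Fin n → B) {i : ℕ} {j : Fin n} (hj : j < i) :
    f j ∈ Ideal.ofList ((List.ofFn f).take i) :=
  Ideal.subset_span <| List.mem_take_iff_getElem.2 ⟨j, by simp [hj], by simp⟩

/-- Contraction with the last coordinate forms is a Koszul cocycle modulo an initial part of the
sequence, and its connecting homomorphism contracts with one more form. -/
theorem iteratedContraction_koszul_sub_mem {M : Type*} [AddCommGroup M] [Module B M]
    (f : Fin n → B) (d : Fin n → Module.Dual B M) {i : ℕ} (hi : i < n) (x : ExteriorAlgebra B M) :
    iteratedContraction (((List.finRange n).drop (i + 1)).map d)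
        (contractLeft (Q := 0) (∑ j, f j • d j) x) -
      f ⟨i, hi⟩ * iteratedContraction (((List.finRange n).drop i).map d) x ∈
        Ideal.ofList ((List.ofFn f).take i) := by
  have hdrop : (List.finRange n).drop i = ⟨i, hi⟩ :: (List.finRange n).drop (i + 1) := by
    rw [List.drop_eq_getElem_cons (by simpa using hi)]
    simp
  rw [hdrop, List.map_cons, iteratedContraction, LinearMap.comp_apply, map_sum,
    LinearMap.sum_apply, map_sum, ← Finset.add_sum_erase _ _ (Finset.mem_univ ⟨i, hi⟩)]
  simp only [map_smul, LinearMap.smul_apply, smul_eq_mul, add_sub_cancel_left]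
  refine Ideal.sum_mem _ fun j hj ↦ ?_
  rcases lt_trichotomy (j : ℕ) i with hji | hji | hji
  · exact Ideal.mul_mem_right _ _ (mem_ofList_take_of_lt f hji)
  · exact absurd (Fin.ext hji) (Finset.ne_of_mem_erase hj)
  · rw [iteratedContraction_contractLeft_of_mem, mul_zero]
    · exact Ideal.zero_mem _
    · exact List.mem_map_of_mem <| List.mem_drop_iff_getElem.2
        ⟨j - (i + 1), by simp; omega, Fin.ext (by simp; omega)⟩

theorem RingTheory.Sequence.IsWeaklyRegular.mem_of_mul_mem {f : Fin n → B}
    (hf : RingTheory.Sequence.IsWeaklyRegular B (List.ofFn f)) {i : ℕ} (hi : i < n) {b : B}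
    (hb : f ⟨i, hi⟩ * b ∈ Ideal.ofList ((List.ofFn f).take i)) :
    b ∈ Ideal.ofList ((List.ofFn f).take i) := by
  have := hf.regular_mod_prev i (by simpa using hi)
  rw [isSMulRegular_quotient_iff_mem_of_smul_mem] at this
  simpa using this b (by simpa using hb)

/-- The comparison of two Koszul complexes over a regular sequence: a transition matrix from the
regular sequence `f` to a sequence `g` in a projective algebra has a determinant which some linear
form sends to `1` modulo `f`. -/
theorem exists_linearMap_det_sub_one_mem {S : Type*} [CommRing S] [Algebra B S] [Module.Free B S]
    {f : Fin n → B} (hf : RingTheory.Sequence.IsWeaklyRegular B (List.ofFn f))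
    {I : Ideal B} (hI : I = Ideal.span (Set.range f))
    {g : Fin n → S} {h : Matrix (Fin n) (Fin n) S}
    (hh : ∀ i, algebraMap B S (f i) = ∑ j, h i j * g j)
    (σ : S →ₗ[B] B ⧸ I) (hσ₁ : σ 1 = 1) (hσ : ∀ x ∈ Ideal.span (Set.range g), σ x = 0) :
    ∃ φ : S →ₗ[B] B, φ h.det - 1 ∈ I := by
  let b := Pi.basisFun B (Fin n)
  let b' := Pi.basisFun S (Fin n)
  let u : (Fin n → B) →ₗ[B] (Fin n → S) := Fintype.linearCombination B (fun i j ↦ h i j)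
  have hu (m k) : u m k = ∑ i, algebraMap B S (m i) * h i k := by
    simp [u, Fintype.linearCombination_apply, Finset.sum_apply, Algebra.smul_def]
  let dF := contractLeft (Q := (0 : QuadraticForm B (Fin n → B))) (∑ j, f j • b.coord j)
  let dE := (contractLeft (Q := (0 : QuadraticForm S (Fin n → S)))
    (∑ j, g j • b'.coord j)).restrictScalars B
  let α := (mapRestrictScalars (S := S) u).toLinearMap
  have hα (x) : α (dF x) = dE (α x) := by
    refine mapRestrictScalars_contractLeft u (fun m ↦ ?_) x
    simp only [b, b', LinearMap.sum_apply, LinearMap.smul_apply, Module.Basis.coord_apply,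
      Pi.basisFun_repr, smul_eq_mul, map_sum, map_mul, hh, hu, Finset.mul_sum, Finset.sum_mul]
    rw [Finset.sum_comm]
    exact Finset.sum_congr rfl fun i _ ↦ Finset.sum_congr rfl fun j _ ↦ by ring
  have : Module.Free B (ExteriorAlgebra S (Fin n → S)) := Module.Free.trans (S := S)
  let c (i : ℕ) := iteratedContraction (((List.finRange n).drop i).map b.coord)
  have key (k : ℕ) : ∀ i, i + k = n →
      ∃ (w : ExteriorAlgebra S (Fin n → S) →ₗ[B] B) (y : ExteriorAlgebra B (Fin n → B) →ₗ[B] B),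
        (∀ x, w (dE x) ∈ Ideal.ofList ((List.ofFn f).take i)) ∧
        ∀ x, w (α x) - c i x - y (dF x) ∈ Ideal.ofList ((List.ofFn f).take i) := by
    induction k with
    | zero =>
      intro i hi
      rw [show i = n from hi, List.take_of_length_le (by simp), ofList_ofFn, ← hI]
      obtain ⟨w, hw⟩ := Module.projective_lifting_property I.mkQ
        (σ.comp ((algebraMapInv (R := S) (M := Fin n → S)).toLinearMap.restrictScalars B))
        I.mkQ_surjective
      replace hw (x) : Ideal.Quotient.mk I (w x) = σ (algebraMapInv x) := LinearMap.congr_fun hw x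
      refine ⟨w, 0, fun x ↦ ?_, fun x ↦ ?_⟩
      · rw [← Ideal.Quotient.eq_zero_iff_mem, hw]
        exact hσ _ (contractLeft_sum_mem g _ algebraMapInv.toLinearMap x)
      · rw [LinearMap.zero_apply, sub_zero, ← Ideal.Quotient.mk_eq_mk_iff_sub_mem, hw]
        have : algebraMapInv (α x) = algebraMap B S (algebraMapInv x) :=
          algebraMapInv_mapRestrictScalars u x
        rw [this, Algebra.algebraMap_eq_smul_one, map_smul, hσ₁]
        simp [c, List.drop_of_length_le, iteratedContraction, Algebra.smul_def]
    | succ k ih =>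
      intro i hik
      have hi : i < n := by omega
      have := ih (i + 1) (by omega)
      rw [ofList_take_succ_ofFn f hi] at this
      exact exists_cocycle_of_cocycle_sup (dE := dE) (dF := dF)
        (fun x ↦ CliffordAlgebra.contractLeft_contractLeft _ x)
        (fun x ↦ CliffordAlgebra.contractLeft_contractLeft _ x) hα
        (fun _ ↦ hf.mem_of_mul_mem hi)
        (fun x ↦ iteratedContraction_koszul_sub_mem f b.coord hi x) this
  obtain ⟨w, y, -, hy⟩ := key n 0 (zero_add n)
  refine ⟨w.comp ((LinearMap.toSpanSingleton S _ (ιMulti S n b')).restrictScalars B), ?_⟩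
  have hdet : α (ιMulti B n b) = h.det • ιMulti S n b' := by
    refine (mapRestrictScalars_ιMulti u b).trans ?_
    rw [← AlternatingMap.map_sum_smul_eq_det_smul]
    congr 1
    ext i k
    simp only [u, b, b', Pi.basisFun_apply, Fintype.linearCombination_apply_single, one_smul,
      Finset.sum_apply, Pi.smul_apply, Pi.single_apply, smul_eq_mul, mul_ite, mul_one, mul_zero,
      Finset.sum_ite_eq, Finset.mem_univ, if_true]
  have hc : c 0 (ιMulti B n b) = 1 := by
    rw [ιMulti_apply, List.ofFn_eq_map]
    simpa [c, Function.comp_def] using iteratedContraction_coord_prod_ι b (List.nodup_finRange n)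
  have h₀ := hy (ιMulti B n b)
  rw [hdet, hc, List.take_zero, Ideal.ofList_nil, Ideal.mem_bot, sub_eq_zero] at h₀
  simp only [LinearMap.comp_apply, LinearMap.coe_restrictScalars, LinearMap.toSpanSingleton_apply]
  rw [h₀, hI]
  exact contractLeft_sum_mem f _ y _

end Koszul

section Tate

variable {A C : Type*} [CommRing A] [CommRing C] [Algebra A C]

/-- The linear form `1 ⊗ φ : C ⊗ C → C`. -/
noncomputable def idTensorForm (φ : C →ₗ[A] A) : C ⊗[A] C →ₗ[A] C :=
  TensorProduct.lift (((LinearMap.lsmul A C).comp φ).flip)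

theorem idTensorForm_tmul (φ : C →ₗ[A] A) (c d : C) : idTensorForm φ (c ⊗ₜ d) = φ d • c := rfl

theorem idTensorForm_tmul_mul (φ : C →ₗ[A] A) (c : C) (x : C ⊗[A] C) :
    idTensorForm φ ((c ⊗ₜ 1) * x) = c * idTensorForm φ x := by
  induction x with
  | zero => simp
  | tmul a b => simp [idTensorForm_tmul]
  | add x y hx hy => rw [mul_add, map_add, hx, hy, map_add, mul_add]

theorem idTensorForm_comp_mul (φ : C →ₗ[A] A) (c : C) (x : C ⊗[A] C) :
    idTensorForm (φ.comp (LinearMap.mul A C c)) x = idTensorForm φ ((1 ⊗ₜ c) * x) := by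
  induction x with
  | zero => simp
  | tmul a b => simp [idTensorForm_tmul]
  | add x y hx hy => rw [map_add, hx, hy, mul_add, map_add]

/-- Evaluating the linear forms against a fixed tensor. -/
noncomputable def tensorEval (x : C ⊗[A] C) : (C →ₗ[A] A) →ₗ[A] C where
  toFun φ := idTensorForm φ x
  map_add' φ ψ := by
    induction x with
    | zero => simp
    | tmul a b => simp [idTensorForm_tmul, add_smul]
    | add x y hx hy => simp only [map_add, hx, hy]; abel
  map_smul' r φ := by
    induction x with
    | zero => simp
    | tmul a b => simp [idTensorForm_tmul, mul_smul]
    | add x y hx hy => simp only [map_add, hx, hy, smul_add]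

theorem LinearMap.injective_of_surjective_dual [Module.Finite A C] [Module.Free A C]
    {T : (C →ₗ[A] A) →ₗ[A] C} (hT : Function.Surjective T) : Function.Injective T := by
  let e := (Module.Free.chooseBasis A C).toDualEquiv
  have := OrzechProperty.injective_of_surjective_endomorphism (T ∘ₗ e.toLinearMap)
    (hT.comp e.surjective)
  intro x y hxy
  obtain ⟨x, rfl⟩ := e.surjective x
  obtain ⟨y, rfl⟩ := e.surjective y
  exact congrArg e (this hxy)

theorem det_mul_mem_span {S κ : Type*} [CommRing S] [Fintype κ] [DecidableEq κ]
    {f g : κ → S} {h : Matrix κ κ S} (hh : ∀ i, f i = ∑ j, h i j * g j) {x : S}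
    (hx : x ∈ Ideal.span (Set.range g)) : x * h.det ∈ Ideal.span (Set.range f) := by
  have hcramer (j) : h.det * g j ∈ Ideal.span (Set.range f) := by
    have : h.adjugate.mulVec f = h.det • g := by
      rw [show f = h.mulVec g from funext hh, Matrix.mulVec_mulVec, Matrix.adjugate_mul,
        Matrix.smul_mulVec, Matrix.one_mulVec]
    rw [← smul_eq_mul, ← Pi.smul_apply, ← this]
    exact Ideal.sum_mem _ fun i _ ↦ Ideal.mul_mem_left _ _ (Ideal.subset_span ⟨i, rfl⟩)
  rw [mul_comm]
  induction hx using Submodule.span_induction with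
  | mem x hx => obtain ⟨j, rfl⟩ := hx; exact hcramer j
  | zero => simp
  | add x y _ _ hx hy => rw [mul_add]; exact Ideal.add_mem _ hx hy
  | smul a x _ hx => rw [smul_eq_mul, mul_left_comm]; exact Ideal.mul_mem_left _ _ hx

end Tate

theorem mk_linearMap_eq_sum_idTensorForm {A B κ : Type*} [CommRing A] [CommRing B] [Algebra A B]
    {I : Ideal B} [Fintype κ] (b : Module.Basis κ A (B ⧸ I))
    (φ : B ⊗[A] (B ⧸ I) →ₗ[B] B) (x : B ⊗[A] (B ⧸ I)) :
    Ideal.Quotient.mk I (φ x) = ∑ k, Ideal.Quotient.mk I (φ (1 ⊗ₜ b k)) *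
      idTensorForm (b.coord k)
        (Algebra.TensorProduct.map (Ideal.Quotient.mkₐ A I) (AlgHom.id A (B ⧸ I)) x) := by
  induction x with
  | zero => simp
  | add x y hx hy => simp only [map_add, hx, hy, mul_add, Finset.sum_add_distrib]
  | tmul a c =>
    have : a ⊗ₜ[A] c = ∑ k, (b.coord k c • a) • ((1 : B) ⊗ₜ[A] b k) := by
      conv_lhs => rw [← b.sum_repr c, TensorProduct.tmul_sum]
      refine Finset.sum_congr rfl fun k _ ↦ ?_
      simp [TensorProduct.smul_tmul']
    have hφ : φ (a ⊗ₜ c) = ∑ k, φ (1 ⊗ₜ b k) * (b.coord k c • a) := by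
      rw [this, map_sum]
      exact Finset.sum_congr rfl fun k _ ↦ by rw [map_smul, smul_eq_mul, mul_comm]
    rw [hφ, map_sum]
    exact Finset.sum_congr rfl fun k _ ↦ map_mul _ _ _

/-- **Tate's isomorphism.**
Let `A` be a commutative ring, `B` an `A`-algebra, `f₁, …, f_n` a regular
sequence in `B` such that `C := B/(f₁, …, f_n)` is finite free over `A`, with
quotient map `π : B → C`.  Let `s : B ⊗_A C → C` be the `A`-algebra map
`b ⊗ c ↦ π(b)·c` and assume its kernel `J` is generated by a regular sequence
`g₁, …, g_n` of `B ⊗_A C`.  Choose `h_{ij}` with `f_i ⊗ 1 = Σ_j h_{ij} g_j`,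
set `Δ = det h` and `Δ̄ = (π ⊗ 1)(Δ) ∈ C ⊗_A C`.  Then the map
`t : Hom_A(C, A) → C`, `t(φ) = (1_C ⊗ φ)(Δ̄)`, is an isomorphism of
`C`-modules. -/
theorem tate_isomorphism
    (A : Type*) [CommRing A] (B : Type*) [CommRing B] [Algebra A B]
    (n : ℕ) (f : Fin n → B)
    (hf : RingTheory.Sequence.IsRegular B (List.ofFn f))
    (I : Ideal B) (hI : I = Ideal.span (Set.range f))
    [Module.Finite A (B ⧸ I)] [Module.Free A (B ⧸ I)]
    -- the diagonal-type map `s : B ⊗_A C → C`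
    (s : B ⊗[A] (B ⧸ I) →ₐ[A] (B ⧸ I))
    (hs : ∀ (b : B) (c : B ⧸ I), s (b ⊗ₜ c) = Ideal.Quotient.mk I b * c)
    (g : Fin n → B ⊗[A] (B ⧸ I))
    (hg : RingTheory.Sequence.IsRegular (B ⊗[A] (B ⧸ I)) (List.ofFn g))
    (hJ : RingHom.ker s = Ideal.span (Set.range g))
    (h : Matrix (Fin n) (Fin n) (B ⊗[A] (B ⧸ I)))
    (hh : ∀ i, (f i) ⊗ₜ[A] (1 : B ⧸ I) = ∑ j, h i j * g j)
    -- `Δ̄ = (π ⊗ 1)(det h)`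
    (Δbar : (B ⧸ I) ⊗[A] (B ⧸ I))
    (hΔbar : Δbar =
      (Algebra.TensorProduct.map (Ideal.Quotient.mkₐ A I) (AlgHom.id A (B ⧸ I))) h.det)
    -- the Tate map `t`
    (T : ((B ⧸ I) →ₗ[A] A) → (B ⧸ I))
    (hT : ∀ φ : (B ⧸ I) →ₗ[A] A,
      T φ = TensorProduct.lift (((LinearMap.lsmul A (B ⧸ I)).comp φ).flip) Δbar) :
    (∀ (c : B ⧸ I) (φ : (B ⧸ I) →ₗ[A] A),
        T (φ.comp (LinearMap.mul A (B ⧸ I) c)) = c * T φ) ∧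
      Function.Bijective T := by
  obtain rfl : T = fun φ ↦ tensorEval Δbar φ := funext hT
  subst hΔbar
  set p := Algebra.TensorProduct.map (Ideal.Quotient.mkₐ A I) (AlgHom.id A (B ⧸ I)) with hp
  have hsmul (c : B ⧸ I) (φ : (B ⧸ I) →ₗ[A] A) :
      tensorEval (p h.det) (φ.comp (LinearMap.mul A (B ⧸ I) c)) =
        c * tensorEval (p h.det) φ := by
    obtain ⟨b, rfl⟩ := Ideal.Quotient.mk_surjective c
    have hker : b ⊗ₜ[A] (1 : B ⧸ I) - 1 ⊗ₜ[A] Ideal.Quotient.mk I b ∈ RingHom.ker s := by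
      simp [RingHom.mem_ker, hs]
    rw [hJ] at hker
    have hmem : Ideal.span (Set.range fun i ↦ f i ⊗ₜ[A] (1 : B ⧸ I)) ≤ RingHom.ker p := by
      rw [Ideal.span_le]
      rintro _ ⟨i, rfl⟩
      have : Ideal.Quotient.mk I (f i) = 0 :=
        Ideal.Quotient.eq_zero_iff_mem.2 (hI ▸ Ideal.subset_span ⟨i, rfl⟩)
      simp [RingHom.mem_ker, hp, this]
    have := hmem (det_mul_mem_span hh hker)
    rw [RingHom.mem_ker, sub_mul, map_sub, sub_eq_zero, map_mul, map_mul] at this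
    refine (idTensorForm_comp_mul _ _ _).trans (Eq.trans ?_ (idTensorForm_tmul_mul _ _ _))
    exact congrArg (idTensorForm φ) (by simpa [hp] using this.symm)
  have hsurj : Function.Surjective (tensorEval (p h.det)) := by
    let σ : B ⊗[A] (B ⧸ I) →ₗ[B] B ⧸ I :=
      { s with
        map_smul' := fun b x ↦ by
          change s (b • x) = Ideal.Quotient.mk I b * s x
          rw [show b • x = algebraMap B (B ⊗[A] (B ⧸ I)) b * x from Algebra.smul_def b x, map_mul,
            Algebra.TensorProduct.algebraMap_apply, hs]
          simp }
    obtain ⟨φ, hφ⟩ := exists_linearMap_det_sub_one_mem hf.toIsWeaklyRegular hI hh σ (map_one s)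
      fun x hx ↦ by rw [← hJ] at hx; exact hx
    let b := Module.Free.chooseBasis A (B ⧸ I)
    rw [← Ideal.Quotient.mk_eq_mk_iff_sub_mem, mk_linearMap_eq_sum_idTensorForm b, map_one] at hφ
    intro c
    refine ⟨(∑ k, (b.coord k).comp (LinearMap.mul A _ (Ideal.Quotient.mk I (φ (1 ⊗ₜ b k))))).comp
      (LinearMap.mul A _ c), ?_⟩
    rw [hsmul, map_sum, Finset.sum_congr rfl fun k _ ↦ hsmul _ _]
    exact (congrArg (c * ·) hφ).trans (mul_one c)
  exact ⟨hsmul, LinearMap.injective_of_surjective_dual hsurj, hsurj⟩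
end

section
/- Let R be a commutative noetherian ring, M an R-module, and t₁, …, t_n an M-regular sequence generating the ideal I. Then the natural map M/(t₁, …, t_n)M → H^n_I(M), sending the class of m to the generalized fraction [m / t₁, …, t_n], is injective. -/
open scoped Pointwise in
theorem mem_pointwise_smul_top_iff {R M : Type*} [CommRing R] [AddCommGroup M] [Module R M]
    {r : R} {x : M} : x ∈ r • (⊤ : Submodule R M) ↔ ∃ y, x = r • y := by
  simp [Submodule.mem_smul_pointwise_iff_exists, eq_comm]

theorem QuotSMulTop.mk_eq_zero_iff {R M : Type*} [CommRing R] [AddCommGroup M] [Module R M]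
    {r : R} {x : M} :
    (Submodule.Quotient.mk x : QuotSMulTop r M) = 0 ↔ ∃ y, x = r • y :=
  (Submodule.Quotient.mk_eq_zero _).trans mem_pointwise_smul_top_iff

theorem QuotSMulTop.map_injective {R A B C : Type*} [CommRing R]
    [AddCommGroup A] [Module R A] [AddCommGroup B] [Module R B] [AddCommGroup C] [Module R C]
    {r : R} {f : A →ₗ[R] B} {g : B →ₗ[R] C} (hf : Function.Injective f)
    (hfg : Function.Exact f g) (hr : IsSMulRegular C r) :
    Function.Injective (QuotSMulTop.map r f) := by
  rw [injective_iff_map_eq_zero]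
  intro a ha
  obtain ⟨y, rfl⟩ := Submodule.Quotient.mk_surjective _ a
  rw [QuotSMulTop.map_apply_mk, QuotSMulTop.mk_eq_zero_iff] at ha
  obtain ⟨x, hx⟩ := ha
  have hgx : g x = 0 := by
    refine hr.right_eq_zero_of_smul ?_
    rw [← map_smul, ← hx]
    exact hfg.apply_apply_eq_zero y
  obtain ⟨w, rfl⟩ := (hfg x).1 hgx
  exact QuotSMulTop.mk_eq_zero_iff.2 ⟨w, hf (by rw [hx, map_smul])⟩

open RingTheory.Sequence in
/-- Weak regularity of a sequence passes to extensions. -/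
theorem RingTheory.Sequence.IsWeaklyRegular.of_exact {R A B C : Type*} [CommRing R]
    [AddCommGroup A] [Module R A] [AddCommGroup B] [Module R B] [AddCommGroup C] [Module R C]
    {f : A →ₗ[R] B} {g : B →ₗ[R] C} (hf : Function.Injective f)
    (hfg : Function.Exact f g) (hg : Function.Surjective g) {rs : List R}
    (hA : IsWeaklyRegular A rs) (hC : IsWeaklyRegular C rs) : IsWeaklyRegular B rs := by
  induction rs generalizing A B C with
  | nil => exact .nil R B
  | cons r rs ih =>
    rw [isWeaklyRegular_cons_iff] at hA hC ⊢
    exact ⟨isSMulRegular_of_range_eq_ker hf hfg.linearMap_ker_eq.symm hA.1 hC.1,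
      ih (QuotSMulTop.map_injective hf hfg hC.1) (QuotSMulTop.map_exact r hfg hg)
        (QuotSMulTop.map_surjective r hg) hA.2 hC.2⟩

theorem RingTheory.Sequence.IsWeaklyRegular.of_subsingleton {R M : Type*} [CommRing R]
    [AddCommGroup M] [Module R M] [Subsingleton M] (rs : List R) :
    RingTheory.Sequence.IsWeaklyRegular M rs :=
  ⟨fun _ _ _ _ _ => Subsingleton.elim _ _⟩

open RingTheory.Sequence in
/-- If `rs` is weakly regular on `M/rM`, where `r` is regular on `M`, then it is weakly regular on
`M/rᵏM`. -/
theorem RingTheory.Sequence.IsWeaklyRegular.quotSMulTop_pow {R M : Type*} [CommRing R]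
    [AddCommGroup M] [Module R M] {r : R} {rs : List R} (hr : IsSMulRegular M r)
    (hrs : IsWeaklyRegular (QuotSMulTop r M) rs) (k : ℕ) :
    IsWeaklyRegular (QuotSMulTop (r ^ k) M) rs := by
  induction k with
  | zero =>
    have : Subsingleton (QuotSMulTop (r ^ 0) M) := by
      refine ⟨fun a b => ?_⟩
      obtain ⟨x, hx⟩ := Submodule.Quotient.mk_surjective _ (a - b)
      rw [← sub_eq_zero, ← hx]
      exact QuotSMulTop.mk_eq_zero_iff.2 ⟨x, by simp⟩
    exact .of_subsingleton rs
  | succ k ih =>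
    let f : QuotSMulTop (r ^ k) M →ₗ[R] QuotSMulTop (r ^ (k + 1)) M :=
      Submodule.mapQ _ _ (LinearMap.lsmul R M r) fun x hx => by
        obtain ⟨y, rfl⟩ := mem_pointwise_smul_top_iff.1 hx
        exact mem_pointwise_smul_top_iff.2 ⟨y, by simp [smul_smul, pow_succ]⟩
    let g : QuotSMulTop (r ^ (k + 1)) M →ₗ[R] QuotSMulTop r M :=
      Submodule.mapQ _ _ LinearMap.id fun x hx => by
        obtain ⟨y, rfl⟩ := mem_pointwise_smul_top_iff.1 hx
        exact mem_pointwise_smul_top_iff.2 ⟨r ^ k • y, by simp [smul_smul, pow_succ']⟩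
    have hf : Function.Injective f := by
      rw [injective_iff_map_eq_zero]
      intro a ha
      obtain ⟨x, rfl⟩ := Submodule.Quotient.mk_surjective _ a
      obtain ⟨y, hy⟩ := QuotSMulTop.mk_eq_zero_iff.1 ha
      exact QuotSMulTop.mk_eq_zero_iff.2 ⟨y, hr (by simpa [smul_smul, pow_succ'] using hy)⟩
    have hfg : Function.Exact f g := by
      intro a
      obtain ⟨x, rfl⟩ := Submodule.Quotient.mk_surjective _ a
      constructor
      · intro h
        obtain ⟨y, rfl⟩ : ∃ y, x = r • y := QuotSMulTop.mk_eq_zero_iff.1 h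
        exact ⟨Submodule.Quotient.mk y, rfl⟩
      · rintro ⟨b, hb⟩
        obtain ⟨y, rfl⟩ := Submodule.Quotient.mk_surjective _ b
        rw [← hb]
        exact QuotSMulTop.mk_eq_zero_iff.2 ⟨y, rfl⟩
    have hg : Function.Surjective g := by
      intro a
      obtain ⟨x, rfl⟩ := Submodule.Quotient.mk_surjective _ a
      exact ⟨Submodule.Quotient.mk x, rfl⟩
    exact ih.of_exact hf hfg hg hrs

/-- Quotients by two elements can be formed in either order. -/
noncomputable def QuotSMulTop.swap {R : Type*} (M : Type*) [CommRing R] [AddCommGroup M]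
    [Module R M] (r s : R) :
    QuotSMulTop s (QuotSMulTop r M) ≃ₗ[R] QuotSMulTop r (QuotSMulTop s M) :=
  Submodule.quotEquivOfEq _ _
      (by rw [Ideal.ofList_singleton, Submodule.ideal_span_singleton_smul]) ≪≫ₗ
    (Submodule.quotOfListConsSMulTopEquivQuotSMulTopInner M r [s]).symm ≪≫ₗ
    Submodule.quotOfListConsSMulTopEquivQuotSMulTopOuter M r [s] ≪≫ₗ
    QuotSMulTop.congr r (Submodule.quotEquivOfEq _ _
      (by rw [Ideal.ofList_singleton, Submodule.ideal_span_singleton_smul]))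

/-- If `r, s` is a regular sequence on `M`, then `r` is regular on `M/sM`. -/
theorem IsSMulRegular.quotSMulTop_swap {R M : Type*} [CommRing R] [AddCommGroup M] [Module R M]
    {r s : R} (hr : IsSMulRegular M r) (hs : IsSMulRegular (QuotSMulTop r M) s) :
    IsSMulRegular (QuotSMulTop s M) r := by
  refine .of_right_eq_zero_of_smul fun a ha => ?_
  obtain ⟨x, rfl⟩ := Submodule.Quotient.mk_surjective _ a
  obtain ⟨z, hz⟩ := QuotSMulTop.mk_eq_zero_iff.1 ha
  obtain ⟨w, rfl⟩ : ∃ w, z = r • w := QuotSMulTop.mk_eq_zero_iff.1 <|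
    hs.right_eq_zero_of_smul (QuotSMulTop.mk_eq_zero_iff.2 ⟨x, hz.symm⟩)
  exact QuotSMulTop.mk_eq_zero_iff.2 ⟨w, hr (hz.trans (smul_comm s r w))⟩

open RingTheory.Sequence in
/-- The first element of a weakly regular sequence is regular modulo powers of the others. -/
theorem RingTheory.Sequence.IsWeaklyRegular.isSMulRegular_quotient_pow {R M : Type*} [CommRing R]
    [AddCommGroup M] [Module R M] {r : R} {rs : List R} (hr : IsSMulRegular M r)
    (hrs : IsWeaklyRegular (QuotSMulTop r M) rs) (k : ℕ) :
    IsSMulRegular (M ⧸ (Ideal.ofList (rs.map (· ^ k)) • (⊤ : Submodule R M))) r := by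
  induction rs generalizing M with
  | nil =>
    refine ((Submodule.quotEquivOfEqBot _ ?_).isSMulRegular_congr r).2 hr
    rw [List.map_nil, Ideal.ofList_nil, Submodule.bot_smul]
  | cons s rs ih =>
    rw [isWeaklyRegular_cons_iff] at hrs
    rw [List.map_cons]
    refine ((Submodule.quotOfListConsSMulTopEquivQuotSMulTopInner M (s ^ k) _).isSMulRegular_congr
      r).2 (ih (hr.quotSMulTop_swap (hrs.1.pow k)) ?_)
    exact ((QuotSMulTop.swap M r (s ^ k)).isWeaklyRegular_congr rs).1
      (hrs.2.quotSMulTop_pow hrs.1 k)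

theorem QuotSMulTop.mk_mem_ofList_smul_top_iff {R M : Type*} [CommRing R] [AddCommGroup M]
    [Module R M] {r : R} {rs : List R} {x : M} :
    (Submodule.Quotient.mk x : QuotSMulTop r M) ∈
        Ideal.ofList rs • (⊤ : Submodule R (QuotSMulTop r M)) ↔
      x ∈ Ideal.ofList (r :: rs) • (⊤ : Submodule R M) := by
  rw [← Submodule.Quotient.mk_eq_zero, ← Submodule.Quotient.mk_eq_zero,
    ← (Submodule.quotOfListConsSMulTopEquivQuotSMulTopInner M r rs).map_eq_zero_iff]
  rfl

open RingTheory.Sequence in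
/-- Multiplication by `(r₁⋯rₙ)ᵏ` induces an injection `M/(r₁,…,rₙ)M → M/(r₁ᵏ⁺¹,…,rₙᵏ⁺¹)M` if
`r₁,…,rₙ` is weakly regular. -/
theorem RingTheory.Sequence.IsWeaklyRegular.mem_of_prod_pow_smul_mem {R M : Type*} [CommRing R]
    [AddCommGroup M] [Module R M] {rs : List R} (h : IsWeaklyRegular M rs) (k : ℕ) {m : M}
    (hm : rs.prod ^ k • m ∈ Ideal.ofList (rs.map (· ^ (k + 1))) • (⊤ : Submodule R M)) :
    m ∈ Ideal.ofList rs • (⊤ : Submodule R M) := by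
  induction rs generalizing M with
  | nil => simpa using hm
  | cons r rs ih =>
    rw [isWeaklyRegular_cons_iff] at h
    rw [List.map_cons, Ideal.ofList_cons_smul, Submodule.mem_sup] at hm
    obtain ⟨a, ha, b, hb, hab⟩ := hm
    obtain ⟨x, rfl⟩ := mem_pointwise_smul_top_iff.1 ha
    have hmem : rs.prod ^ k • m - r • x ∈
        Ideal.ofList (rs.map (· ^ (k + 1))) • (⊤ : Submodule R M) := by
      refine mem_of_isSMulRegular_quotient_of_smul_mem
        ((h.2.isSMulRegular_quotient_pow h.1 (k + 1)).pow k) ?_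
      convert hb using 1
      rw [eq_sub_of_add_eq' hab, List.prod_cons, mul_pow, smul_sub, smul_smul, smul_smul, pow_succ]
    refine QuotSMulTop.mk_mem_ofList_smul_top_iff.1 (ih h.2 ?_)
    rw [← Submodule.Quotient.mk_smul]
    refine QuotSMulTop.mk_mem_ofList_smul_top_iff.2 ?_
    rw [Ideal.ofList_cons_smul, Submodule.mem_sup]
    exact ⟨r • x, mem_pointwise_smul_top_iff.2 ⟨x, rfl⟩, _, hmem, by abel⟩

theorem Ideal.ofList_map_ofFn {R : Type*} [CommRing R] {n : ℕ} (t : Fin n → R) (k : ℕ) :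
    Ideal.ofList ((List.ofFn t).map (· ^ k)) = Ideal.span (Set.range fun i => t i ^ k) := by
  refine congrArg Ideal.span (Set.ext fun x => ?_)
  simp [List.map_ofFn, List.mem_ofFn]

/-- **Injectivity of the generalized-fraction map.**
Let `R` be a commutative noetherian ring, `M` an `R`-module and `t₁, …, t_n`
an `M`-regular sequence generating the ideal `I`.  Realize `H^n_I(M)` as the
direct limit of the system `G k = M/(t₁^k, …, t_n^k)M` whose transition maps
are multiplication by `t₁⋯t_n`.  Then the natural map
`M/(t₁, …, t_n)M → H^n_I(M)`, `[m] ↦ [m / t₁, …, t_n]`, is injective. -/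
theorem generalized_fraction_map_injective
    (R : Type*) [CommRing R] [IsNoetherianRing R]
    (M : Type*) [AddCommGroup M] [Module R M]
    (n : ℕ) (t : Fin n → R)
    (hreg : RingTheory.Sequence.IsRegular M (List.ofFn t))
    (G : ℕ → Type*) [∀ k, AddCommGroup (G k)] [∀ k, Module R (G k)]
    (e : ∀ k, G k ≃ₗ[R]
      (M ⧸ (Ideal.span (Set.range fun i => t i ^ k) • (⊤ : Submodule R M))))
    (f : ∀ i j : ℕ, i ≤ j → G i →ₗ[R] G j)
    [DirectedSystem G fun i j h => f i j h]
    (hstep : ∀ (k : ℕ) (m : M),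
      f k (k + 1) (Nat.le_succ k) ((e k).symm (Submodule.Quotient.mk m)) =
        (e (k + 1)).symm (Submodule.Quotient.mk ((∏ i, t i) • m))) :
    Function.Injective fun m : M ⧸
        (Ideal.span (Set.range fun i => t i ^ 1) • (⊤ : Submodule R M)) =>
      Module.DirectLimit.of R ℕ G f 1 ((e 1).symm m) := by
  refine (injective_iff_map_eq_zero
    ((Module.DirectLimit.of R ℕ G f 1).comp (e 1).symm.toLinearMap)).2 ?_
  intro a ha
  obtain ⟨m, rfl⟩ := Submodule.Quotient.mk_surjective _ a
  have htrans (k : ℕ) : f 1 (k + 1) (Nat.le_add_left 1 k)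
      ((e 1).symm (Submodule.Quotient.mk m)) =
        (e (k + 1)).symm (Submodule.Quotient.mk ((∏ i, t i) ^ k • m)) := by
    induction k with
    | zero => simpa using DirectedSystem.map_self (f := fun i j h => f i j h) _
    | succ k ih =>
      rw [← DirectedSystem.map_map (f := fun i j h => f i j h) (Nat.le_add_left 1 k)
        (Nat.le_succ (k + 1)), ih, hstep, smul_smul, ← pow_succ']
  obtain ⟨j, hj, h0⟩ := Module.DirectLimit.of.zero_exact ha
  obtain ⟨k, rfl⟩ := Nat.exists_eq_add_of_le' hj
  have h1 := (htrans k).symm.trans h0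
  rw [LinearEquiv.map_eq_zero_iff, Submodule.Quotient.mk_eq_zero, ← Ideal.ofList_map_ofFn,
    ← List.prod_ofFn] at h1
  rw [Submodule.Quotient.mk_eq_zero, ← Ideal.ofList_map_ofFn]
  simpa only [pow_one, List.map_id'] using hreg.toIsWeaklyRegular.mem_of_prod_pow_smul_mem k h1
end

section
/- Let (A, n) → (R, m) be a flat local homomorphism of commutative noetherian local rings whose closed fiber R/nR is Cohen–Macaulay of dimension r. Let t₁, …, t_r ∈ m be elements such that R/(nR + (t₁, …, t_r)) is Artinian (equivalently, the images of the t_i form a system of parameters of R/nR). Then t₁, …, t_r is an R-regular sequence and R/(t₁, …, t_r) is flat over A. -/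
open IsLocalRing RingTheory.Sequence Pointwise

section Parameters

universe u

open CategoryTheory Abelian Limits

variable {B : Type u} [CommRing B] [IsNoetherianRing B] [IsLocalRing B]

theorem exists_isAssociatedPrime_quotSMulTop {M : Type*} [AddCommGroup M] [Module B M]
    [Module.Finite B M] {p : Ideal B} (hp : IsAssociatedPrime p M) {w : B}
    (hw : IsSMulRegular M w) (hwm : w ∈ maximalIdeal B) :
    ∃ q, IsAssociatedPrime q (QuotSMulTop w M) ∧ p < q := by
  obtain ⟨hprime, x, hx⟩ := isAssociatedPrime_iff.mp hp
  have hx0 : x ≠ 0 := by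
    rintro rfl
    exact hprime.ne_top (by simp [hx])
  let N := Submodule.torsionBySet B M p
  have hN {y : M} : y ∈ N ↔ ∀ a ∈ p, a • y = 0 := by simp [N]
  have hxN : x ∈ N := hN.mpr fun a ha ↦ by
    rw [hx] at ha
    simpa using ha
  obtain ⟨y, hyN, hy⟩ : ∃ y ∈ N, y ∉ w • N := by
    by_contra! h
    refine hx0 <| (Submodule.eq_bot_iff _).mp (Submodule.eq_bot_of_le_smul_of_le_jacobson_bot
      (Ideal.span {w}) N (IsNoetherian.noetherian N) ?_ ?_) x hxN
    · rwa [Submodule.ideal_span_singleton_smul]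
    · rw [jacobson_eq_maximalIdeal ⊥ bot_ne_top]
      exact (Ideal.span_singleton_le_iff_mem _).mpr hwm
  have hy' : (Submodule.Quotient.mk y : QuotSMulTop w M) ≠ 0 := by
    rw [ne_eq, Submodule.Quotient.mk_eq_zero, Submodule.mem_smul_pointwise_iff_exists]
    rintro ⟨z, -, rfl⟩
    refine hy <| Submodule.smul_mem_pointwise_smul _ _ _ <|
      hN.mpr fun a ha ↦ hw.right_eq_zero_of_smul ?_
    rw [smul_comm]
    exact hN.mp hyN a ha
  obtain ⟨q, hq, hle⟩ := exists_le_isAssociatedPrime_of_isNoetherianRing B _ hy'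
  refine ⟨q, hq, lt_of_le_of_ne (fun a ha ↦ hle ?_) fun h ↦ hx0 <| hw.right_eq_zero_of_smul ?_⟩
  · rw [Submodule.mem_colon_singleton, ← Submodule.Quotient.mk_smul, hN.mp hyN a ha]
    simp
  · have hwq : w ∈ q := hle <| by
      rw [Submodule.mem_colon_singleton, ← Submodule.Quotient.mk_smul, Submodule.mem_bot,
        Submodule.Quotient.mk_eq_zero]
      exact Submodule.smul_mem_pointwise_smul _ _ _ Submodule.mem_top
    rw [← h] at hwq
    exact hN.mp hxN w hwq

theorem length_le_coheight_of_isAssociatedPrime {M : Type*} [AddCommGroup M] [Module B M]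
    [Module.Finite B M] {p : PrimeSpectrum B} (hp : IsAssociatedPrime p.asIdeal M) {ws : List B}
    (hws : IsWeaklyRegular M ws) (hwm : ∀ w ∈ ws, w ∈ maximalIdeal B) :
    (ws.length : ℕ∞) ≤ Order.coheight p := by
  induction ws generalizing M p with
  | nil => simp
  | cons w ws ih =>
    rw [isWeaklyRegular_cons_iff] at hws
    obtain ⟨q, hq, hlt⟩ := exists_isAssociatedPrime_quotSMulTop hp hws.1 (hwm w (by simp))
    have := ih (p := ⟨q, hq.isPrime⟩) hq hws.2 fun w hw ↦ hwm w (by simp [hw])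
    rw [List.length_cons, Nat.cast_succ]
    exact (add_le_add_left this 1).trans (Order.coheight_add_one_le hlt)

theorem supportDim_le_length {M : Type*} [AddCommGroup M] [Module B M] [Module.Finite B M]
    {ts : List B} (htm : ∀ t ∈ ts, t ∈ maximalIdeal B)
    (hts : Module.support B M ∩ PrimeSpectrum.zeroLocus (Ideal.ofList ts) ⊆ {closedPoint B}) :
    Module.supportDim B M ≤ ts.length := by
  induction ts generalizing M with
  | nil =>
    have : Subsingleton (Module.support B M) := by
      have hsub : Module.support B M ⊆ {closedPoint B} := by simpa using hts
      exact (Set.subsingleton_coe _).mpr (Set.subsingleton_singleton.anti hsub)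
    simpa using! Order.krullDim_nonpos_of_subsingleton (α := Module.support B M)
  | cons t ts ih =>
    refine (Module.supportDim_le_supportDim_quotSMulTop_succ (htm t (by simp))).trans ?_
    rw [List.length_cons, Nat.cast_succ]
    refine add_le_add_left (ih (fun t ht ↦ htm t (by simp [ht])) ?_) 1
    rw [Module.support_quotSMulTop, Set.inter_assoc]
    rwa [Ideal.ofList_cons, PrimeSpectrum.zeroLocus_sup, PrimeSpectrum.zeroLocus_span] at hts

/-- Over a noetherian local ring, a system of parameters of length at most the depth (expressed
by vanishing of `Ext` from the residue field) is weakly regular. -/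
theorem isWeaklyRegular_of_subsingleton_ext (M : ModuleCat.{u} B) [Module.Finite B M]
    [Nontrivial M] (ts : List B) (htm : ∀ t ∈ ts, t ∈ maximalIdeal B)
    (hts : Module.support B M ∩ PrimeSpectrum.zeroLocus (Ideal.ofList ts) ⊆ {closedPoint B})
    (hext : ∀ i < ts.length, Subsingleton (Ext (ModuleCat.of B (B ⧸ maximalIdeal B)) M i)) :
    IsWeaklyRegular M ts := by
  induction ts generalizing M with
  | nil => simp
  | cons t ts ih =>
    have ht := htm t (by simp)
    have htm' : ∀ s ∈ ts, s ∈ maximalIdeal B := fun s hs ↦ htm s (by simp [hs])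
    rw [Ideal.ofList_cons, PrimeSpectrum.zeroLocus_sup, PrimeSpectrum.zeroLocus_span] at hts
    have hlt : maximalIdeal B • (⊤ : Submodule B M) < ⊤ :=
      (Submodule.top_ne_ideal_smul_of_le_jacobson_annihilator
        (maximalIdeal_le_jacobson _)).symm.lt_top
    have hsupp : Module.support B (ModuleCat.of B (B ⧸ maximalIdeal B)) =
        PrimeSpectrum.zeroLocus (maximalIdeal B) := by
      change Module.support B (B ⧸ maximalIdeal B) = _
      rw [Module.support_eq_zeroLocus, Ideal.annihilator_quotient]
    have hreg : IsSMulRegular M t := by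
      obtain ⟨ws, hlen, hwm, hws⟩ := ModuleCat.exists_isRegular_of_exists_subsingleton_ext
        (maximalIdeal B) _ M hlt _ hsupp hext
      by_contra hreg
      have hmem : t ∈ ⋃ p ∈ associatedPrimes B M, (p : Set B) := by
        rw [biUnion_associatedPrimes_eq_compl_regular]
        exact hreg
      simp only [Set.mem_iUnion] at hmem
      obtain ⟨p, hp, htp⟩ := hmem
      have hpp : p.IsPrime := IsAssociatedPrime.isPrime hp
      have hle := length_le_coheight_of_isAssociatedPrime (p := ⟨p, hpp⟩) hp hws.1 hwm
      have hsuppp : Module.support B (B ⧸ p) = Set.Ici (⟨p, hpp⟩ : PrimeSpectrum B) := by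
        rw [Module.support_eq_zeroLocus, Ideal.annihilator_quotient]
        rfl
      have hge : Module.supportDim B (B ⧸ p) ≤ ts.length := by
        refine supportDim_le_length htm' fun q ⟨hq₁, hq₂⟩ ↦ hts ⟨?_, ?_, hq₂⟩
        · rw [hsuppp] at hq₁
          rw [Module.mem_support_iff_of_finite]
          exact (Submodule.annihilator_top (R := B) (M := M)).symm.le.trans
            ((IsAssociatedPrime.annihilator_le hp).trans hq₁)
        · rw [hsuppp] at hq₁
          simpa using! hq₁ htp
      rw [Module.supportDim, hsuppp, ← Order.coheight_eq_krullDim_Ici] at hge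
      have := (WithBot.coe_le_coe.mpr hle).trans hge
      rw [hlen] at this
      have : ts.length + 1 ≤ ts.length := by exact_mod_cast this
      omega
    have : Nontrivial (QuotSMulTop t M) := nontrivial_quotSMulTop_of_mem_maximalIdeal M ht
    refine .cons hreg (ih (ModuleCat.of B (QuotSMulTop t M)) htm' ?_ fun i hi ↦ ?_)
    · change Module.support B (QuotSMulTop t M) ∩ _ ⊆ _
      rwa [Module.support_quotSMulTop, Set.inter_assoc]
    · have h₁ := AddCommGrpCat.isZero_of_iff_subsingleton.mpr (hext i (by simp; omega))
      have h₂ := AddCommGrpCat.isZero_of_iff_subsingleton.mpr (hext (i + 1) (by simp; omega))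
      exact AddCommGrpCat.subsingleton_of_isZero <| ShortComplex.Exact.isZero_of_both_zeros
        (Ext.covariant_sequence_exact₃' _ hreg.smulShortComplex_shortExact i (i + 1) rfl)
        (h₁.eq_zero_of_src _) (h₂.eq_zero_of_tgt _)

/-- In a noetherian local ring admitting a regular sequence of length `n`, any `n` elements of the
maximal ideal generating an ideal primary to it form a weakly regular sequence. -/
theorem isWeaklyRegular_of_isRegular_of_length_eq {ws ts : List B}
    (hws : IsRegular B ws) (hwm : ∀ w ∈ ws, w ∈ maximalIdeal B)
    (htm : ∀ t ∈ ts, t ∈ maximalIdeal B) (hlen : ws.length = ts.length)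
    (hts : PrimeSpectrum.zeroLocus (Ideal.ofList ts) ⊆ {closedPoint B}) :
    IsWeaklyRegular B ts := by
  refine isWeaklyRegular_of_subsingleton_ext (ModuleCat.of B B) ts htm
    (Set.inter_subset_right.trans hts) fun i hi ↦
      ModuleCat.subsingleton_ext_of_exists_isRegular (maximalIdeal B)
        (ModuleCat.of B (B ⧸ maximalIdeal B)) ?_ (ModuleCat.of B B) ?_ ws hwm hws i (hlen ▸ hi)
  · change Module.support B (B ⧸ maximalIdeal B) ⊆ _
    rw [Module.support_eq_zeroLocus, Ideal.annihilator_quotient]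
  · exact (Submodule.top_ne_ideal_smul_of_le_jacobson_annihilator (M := B)
      (maximalIdeal_le_jacobson _)).symm.lt_top

end Parameters

section FlatQuotient

variable {A M : Type*} [CommRing A] [AddCommGroup M] [Module A M]

theorem Submodule.mem_span_range_smul_top_iff {l : ℕ} (f : Fin l → A) (x : M) :
    x ∈ Ideal.span (Set.range f) • (⊤ : Submodule A M) ↔
      ∃ y : Fin l → M, x = ∑ i, f i • y i := by
  constructor
  · intro hx
    induction hx using Submodule.smul_induction_on' with
    | smul a ha m _ =>
      obtain ⟨c, rfl⟩ := Ideal.mem_span_range_iff_exists_fun.mp ha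
      exact ⟨fun i ↦ c i • m, by simp [Finset.sum_smul, smul_smul, mul_comm]⟩
    | add x _ y _ hx hy =>
      obtain ⟨u, rfl⟩ := hx
      obtain ⟨v, rfl⟩ := hy
      exact ⟨u + v, by simp [Finset.sum_add_distrib]⟩
  · rintro ⟨y, rfl⟩
    exact Submodule.sum_mem _ fun i _ ↦
      Submodule.smul_mem_smul (Ideal.subset_span ⟨i, rfl⟩) Submodule.mem_top

theorem Module.Flat.mem_colon_smul_top [IsNoetherianRing A] [Module.Flat A M] {J : Ideal A}
    {a : A} {x : M} (h : a • x ∈ J • (⊤ : Submodule A M)) :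
    x ∈ (J.colon {a} : Ideal A) • (⊤ : Submodule A M) := by
  obtain ⟨l, f, rfl⟩ := Submodule.fg_iff_exists_fin_generating_family.mp
    ((isNoetherianRing_iff_ideal_fg A).mp inferInstance J)
  obtain ⟨y, hy⟩ := (Submodule.mem_span_range_smul_top_iff f (a • x)).mp h
  have hrel : ∑ i : Option (Fin l), (i.elim a f) • (i.elim x (fun j ↦ -y j)) = 0 := by
    simp [Fintype.sum_option, hy]
  obtain ⟨k, b, z, hz, hb⟩ := Module.Flat.isTrivialRelation_of_sum_smul_eq_zero hrel
  have hx : x = ∑ j, b none j • z j := hz none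
  rw [hx]
  refine Submodule.sum_mem _ fun j _ ↦ Submodule.smul_mem_smul ?_ Submodule.mem_top
  have hj := hb j
  simp only [Fintype.sum_option, Option.elim] at hj
  rw [Submodule.mem_colon_singleton, smul_eq_mul, mul_comm, eq_neg_of_add_eq_zero_left hj]
  exact neg_mem <| Submodule.sum_mem _ fun i _ ↦
    Ideal.mul_mem_right _ _ (Ideal.subset_span ⟨i, rfl⟩)

/-- The Krull intersection theorem for the filtration of `M / JM` by powers of the maximal ideal
of the base. -/
theorem IsLocalRing.mem_smul_top_of_forall_mem_sup_pow (R : Type*) [CommRing R] [Algebra A R]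
    [Module R M] [IsScalarTower A R M] [IsLocalRing A] [IsNoetherianRing R] [IsLocalRing R]
    [IsLocalHom (algebraMap A R)] [Module.Finite R M] (J : Ideal A) (x : M)
    (hx : ∀ k, x ∈ (J ⊔ maximalIdeal A ^ k) • (⊤ : Submodule A M)) :
    x ∈ J • (⊤ : Submodule A M) := by
  have key (I : Ideal A) (y : M) : y ∈ I • (⊤ : Submodule A M) ↔
      y ∈ I.map (algebraMap A R) • (⊤ : Submodule R M) := by
    rw [← Submodule.restrictScalars_mem A (I.map (algebraMap A R) • (⊤ : Submodule R M)),
      Ideal.smul_restrictScalars, Submodule.restrictScalars_top]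
  have hmap : (maximalIdeal A).map (algebraMap A R) ≤ maximalIdeal R := map_maximalIdeal_le _
  rw [key, ← Submodule.Quotient.mk_eq_zero, ← Submodule.mem_bot R,
    ← Ideal.iInf_pow_smul_eq_bot_of_isLocalRing (maximalIdeal R) Ideal.IsPrime.ne_top',
    Submodule.mem_iInf]
  intro k
  have hk := (key _ _).mp (hx k)
  rw [Ideal.map_sup, Submodule.sup_smul] at hk
  obtain ⟨y, hy, z, hz, rfl⟩ := Submodule.mem_sup.mp hk
  rw [Submodule.Quotient.mk_add, (Submodule.Quotient.mk_eq_zero _).mpr hy, zero_add]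
  rw [Ideal.map_pow] at hz
  exact Submodule.smul_top_le_comap_smul_top _ (Submodule.mkQ _) <|
    Submodule.smul_mono_left (Ideal.pow_right_mono hmap k) hz

variable {R : Type*} [CommRing R] [Algebra A R] [Module R M] [IsScalarTower A R M]

/-- An element of `R` acting injectively on the closed fiber `M / nM` of a flat module acts
injectively on `M / JM` for every `n`-primary ideal `J`. -/
theorem Module.Flat.mem_smul_top_of_smul_mem [IsNoetherianRing A] [IsLocalRing A]
    [Module.Flat A M] {t : R}
    (ht : ∀ x : M, t • x ∈ maximalIdeal A • (⊤ : Submodule A M) →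
      x ∈ maximalIdeal A • (⊤ : Submodule A M))
    (k : ℕ) (J : Ideal A) (hJ : maximalIdeal A ^ k ≤ J) (x : M)
    (hx : t • x ∈ J • (⊤ : Submodule A M)) : x ∈ J • (⊤ : Submodule A M) := by
  induction J using IsNoetherian.induction generalizing x with
  | hgt J ih =>
  by_cases hJtop : J = ⊤
  · simp [hJtop]
  obtain ⟨a, haJ, ha⟩ : ∃ a ∉ J, ∀ b ∈ maximalIdeal A, b * a ∈ J := by
    classical
    have hex : ∃ k, maximalIdeal A ^ k ≤ J := ⟨k, hJ⟩
    obtain ⟨j, hj⟩ : ∃ j, Nat.find hex = j + 1 := by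
      refine Nat.exists_eq_succ_of_ne_zero fun h0 ↦ hJtop ?_
      simpa [h0] using Nat.find_spec hex
    obtain ⟨a, ha, haJ⟩ := SetLike.not_le_iff_exists.mp (Nat.find_min hex (m := j) (by omega))
    refine ⟨a, haJ, fun b hb ↦ Nat.find_spec hex ?_⟩
    rw [hj, pow_succ']
    exact Ideal.mul_mem_mul hb ha
  have hlt : J < J ⊔ Ideal.span {a} := by
    refine lt_of_le_of_ne le_sup_left fun h ↦ haJ ?_
    rw [h]
    exact Ideal.mem_sup_right (Ideal.mem_span_singleton_self a)
  have hx' := ih _ hlt (hJ.trans hlt.le) x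
    (Submodule.smul_mono_left hlt.le hx)
  rw [Submodule.sup_smul, Submodule.ideal_span_singleton_smul] at hx'
  obtain ⟨y, hy, w, hw, rfl⟩ := Submodule.mem_sup.mp hx'
  obtain ⟨z, -, rfl⟩ := (Submodule.mem_smul_pointwise_iff_exists _ _ _).mp hw
  have hty : t • y ∈ J • (⊤ : Submodule A M) :=
    Submodule.smul_top_le_comap_smul_top J (Algebra.lsmul A A M t) hy
  have htz : a • (t • z) ∈ J • (⊤ : Submodule A M) := by
    rw [smul_add] at hx
    have := Submodule.sub_mem _ hx hty
    rwa [add_sub_cancel_left, smul_comm] at this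
  have hcolon : (J.colon {a} : Ideal A) ≤ maximalIdeal A :=
    le_maximalIdeal fun h ↦ haJ <| by
      simpa using Submodule.mem_colon_singleton.mp (h ▸ Submodule.mem_top : (1 : A) ∈ J.colon {a})
  have hz := ht z (Submodule.smul_mono_left hcolon (Module.Flat.mem_colon_smul_top htz))
  refine add_mem hy ?_
  have : a • z ∈ a • (maximalIdeal A • (⊤ : Submodule A M)) :=
    Submodule.smul_mem_pointwise_smul _ _ _ hz
  rw [← Submodule.ideal_span_singleton_smul, ← Submodule.smul_assoc] at this
  refine Submodule.smul_mono_left ?_ this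
  rw [smul_eq_mul, Ideal.span_singleton_mul_le_iff]
  intro b hb
  rw [mul_comm]
  exact ha b hb

variable [IsNoetherianRing A] [IsLocalRing A] [IsNoetherianRing R] [IsLocalRing R]
  [IsLocalHom (algebraMap A R)] [Module.Finite R M]

/-- The local criterion for a single element: an element acting injectively on the closed fiber
of a flat module is regular with flat quotient. -/
theorem Module.Flat.isSMulRegular_and_flat_quotSMulTop [Module.Flat A M] {t : R}
    (ht : IsSMulRegular
      (M ⧸ (maximalIdeal A).map (algebraMap A R) • (⊤ : Submodule R M)) t) :
    IsSMulRegular M t ∧ Module.Flat A (QuotSMulTop t M) := by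
  have hreg (J : Ideal A) (x : M) (hx : t • x ∈ J • (⊤ : Submodule A M)) :
      x ∈ J • (⊤ : Submodule A M) := by
    refine mem_smul_top_of_forall_mem_sup_pow R J x fun k ↦
      mem_smul_top_of_smul_mem (t := t) (fun y hy ↦ ?_) k _ le_sup_right x
        (Submodule.smul_mono_left le_sup_left hx)
    rw [← Submodule.restrictScalars_top A R M, ← Ideal.smul_restrictScalars] at hy ⊢
    exact mem_of_isSMulRegular_quotient_of_smul_mem ht hy
  refine ⟨isSMulRegular_iff_right_eq_zero_of_smul.mpr fun x hx ↦ by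
      simpa using hreg ⊥ x (by simp [hx]),
    Module.Flat.of_forall_isTrivialRelation fun {l f x} hfx ↦ ?_⟩
  choose m hm using fun i ↦ Submodule.mkQ_surjective (t • (⊤ : Submodule R M)) (x i)
  have hsum : ∑ i, f i • m i ∈ t • (⊤ : Submodule R M) := by
    rw [← Submodule.Quotient.mk_eq_zero, ← Submodule.mkQ_apply, map_sum, ← hfx]
    refine Finset.sum_congr rfl fun i _ ↦ ?_
    rw [← hm]
    rfl
  obtain ⟨y, -, hy⟩ := (Submodule.mem_smul_pointwise_iff_exists _ _ _).mp hsum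
  obtain ⟨v, rfl⟩ := (Submodule.mem_span_range_smul_top_iff f y).mp <| hreg _ y <|
    (Submodule.mem_span_range_smul_top_iff f (t • y)).mpr ⟨m, hy⟩
  have hrel : ∑ i, f i • (m i - t • v i) = 0 := by
    simp only [smul_sub, Finset.sum_sub_distrib, ← hy, Finset.smul_sum]
    rw [sub_eq_zero]
    exact Finset.sum_congr rfl fun i _ ↦ smul_comm _ _ _
  obtain ⟨k, b, z, hz, hb⟩ := Module.Flat.isTrivialRelation_of_sum_smul_eq_zero hrel
  refine ⟨k, b, fun j ↦ Submodule.Quotient.mk (z j), fun i ↦ ?_, hb⟩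
  have hmi : m i = t • v i + ∑ j, b i j • z j := by rw [← hz, add_sub_cancel]
  rw [← hm, hmi, map_add, Submodule.mkQ_apply, (Submodule.Quotient.mk_eq_zero _).mpr
    (Submodule.smul_mem_pointwise_smul _ _ _ Submodule.mem_top), zero_add, map_sum]
  rfl

/-- A sequence that is weakly regular on the closed fiber of a flat module is weakly regular on the
module, with flat quotient. -/
theorem Module.Flat.isWeaklyRegular_and_flat_quotient [Module.Flat A M] {ts : List R}
    (ht : IsWeaklyRegular
      (M ⧸ (maximalIdeal A).map (algebraMap A R) • (⊤ : Submodule R M)) ts) :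
    IsWeaklyRegular M ts ∧ Module.Flat A (M ⧸ Ideal.ofList ts • (⊤ : Submodule R M)) := by
  induction ts generalizing M with
  | nil =>
    refine ⟨.nil R M, .of_linearEquiv ((Submodule.quotEquivOfEqBot _ ?_).restrictScalars A)⟩
    simp
  | cons t ts ih =>
    rw [isWeaklyRegular_cons_iff] at ht
    obtain ⟨h₁, h₂⟩ := isSMulRegular_and_flat_quotSMulTop ht.1
    set I := (maximalIdeal A).map (algebraMap A R)
    let e : QuotSMulTop t (M ⧸ I • (⊤ : Submodule R M)) ≃ₗ[R]
        QuotSMulTop t M ⧸ I • (⊤ : Submodule R (QuotSMulTop t M)) :=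
      Submodule.quotEquivOfEq _ _
          (by rw [Submodule.map_pointwise_smul, Submodule.map_top, Submodule.range_mkQ]) ≪≫ₗ
        Submodule.quotientQuotientEquivQuotientSup (I • ⊤) (t • ⊤) ≪≫ₗ
        Submodule.quotEquivOfEq _ _ (sup_comm _ _) ≪≫ₗ
        (Submodule.quotientQuotientEquivQuotientSup (t • ⊤) (I • ⊤)).symm ≪≫ₗ
        Submodule.quotEquivOfEq _ _
          (by rw [Submodule.map_smul'', Submodule.map_top, Submodule.range_mkQ])
    obtain ⟨h₃, h₄⟩ := ih ((e.isWeaklyRegular_congr ts).mp ht.2)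
    exact ⟨.cons h₁ h₃, .of_linearEquiv
      ((Submodule.quotOfListConsSMulTopEquivQuotSMulTopInner M t ts).restrictScalars A)⟩

end FlatQuotient

/-- **Parameters in a flat family with Cohen–Macaulay fibers.**
Let `(A,n) → (R,m)` be a flat local homomorphism of commutative noetherian
local rings whose closed fiber `R/nR` is Cohen–Macaulay of dimension `r`
(encoded, as usual, by `dim R/nR = r` together with the existence of a
length-`r` regular sequence of nonunits in `R/nR`, i.e. `depth = dim`).
If `t₁, …, t_r ∈ m` are such that `R/(nR + (t₁, …, t_r))` is Artinian, then
`t₁, …, t_r` is an `R`-regular sequence and `R/(t₁, …, t_r)` is flat over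
`A`. -/
theorem regular_and_flat_of_parameters_in_CM_fiber
    (A R : Type*) [CommRing A] [CommRing R] [IsNoetherianRing A] [IsNoetherianRing R]
    [IsLocalRing A] [IsLocalRing R] [Algebra A R] [Module.Flat A R]
    [IsLocalHom (algebraMap A R)]
    (r : ℕ)
    -- Cohen–Macaulay of dimension `r` for the closed fiber `R/nR`:
    (hdim : ringKrullDim (R ⧸ Ideal.map (algebraMap A R) (IsLocalRing.maximalIdeal A)) =
      ((r : ℕ) : WithBot (WithTop ℕ)))
    (hdepth : ∃ w : Fin r → (R ⧸ Ideal.map (algebraMap A R) (IsLocalRing.maximalIdeal A)),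
      RingTheory.Sequence.IsRegular
        (R ⧸ Ideal.map (algebraMap A R) (IsLocalRing.maximalIdeal A)) (List.ofFn w) ∧
        ∀ i, ¬ IsUnit (w i))
    (t : Fin r → R) (ht : ∀ i, t i ∈ IsLocalRing.maximalIdeal R)
    (hart : IsArtinianRing
      (R ⧸ (Ideal.map (algebraMap A R) (IsLocalRing.maximalIdeal A) ⊔
        Ideal.span (Set.range t)))) :
    RingTheory.Sequence.IsRegular R (List.ofFn t) ∧
      Module.Flat A (R ⧸ Ideal.span (Set.range t)) := by
  set I := Ideal.map (algebraMap A R) (maximalIdeal A)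
  have hspan : Ideal.ofList (List.ofFn t) = Ideal.span (Set.range t) := by
    simp [Ideal.ofList, List.mem_ofFn', Set.range]
  have htm : ∀ s ∈ List.ofFn t, s ∈ maximalIdeal R := by
    simpa [List.mem_ofFn'] using ht
  have : Nontrivial (R ⧸ I) :=
    Ideal.Quotient.nontrivial_iff.mpr (map_maximalIdeal_lt_top (algebraMap A R)).ne
  have : IsLocalRing (R ⧸ I) := .of_surjective' _ Ideal.Quotient.mk_surjective
  have : IsLocalHom (Ideal.Quotient.mk I) := .of_surjective _ Ideal.Quotient.mk_surjective
  obtain ⟨w, hw, hwu⟩ := hdepth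
  have hfiber : IsWeaklyRegular (R ⧸ I) ((List.ofFn t).map (algebraMap R (R ⧸ I))) := by
    refine isWeaklyRegular_of_isRegular_of_length_eq hw ?_ ?_ (by simp) fun q hq ↦ ?_
    · simpa [List.mem_ofFn'] using hwu
    · intro s hs
      obtain ⟨x, hx, rfl⟩ := List.mem_map.mp hs
      exact map_nonunit (Ideal.Quotient.mk I) x (htm x hx)
    · rw [← Ideal.map_ofList, hspan, PrimeSpectrum.mem_zeroLocus, SetLike.coe_subset_coe,
        Ideal.map_le_iff_le_comap] at hq
      have hle : I ⊔ Ideal.span (Set.range t) ≤ q.asIdeal.comap (Ideal.Quotient.mk I) :=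
        sup_le (I.mk_ker.symm.le.trans (Ideal.comap_mono bot_le)) hq
      have hsurj : Function.Surjective (Ideal.quotientMap q.asIdeal (Ideal.Quotient.mk I) hle) :=
        Ideal.quotientMap_surjective Ideal.Quotient.mk_surjective
      have := hsurj.isArtinianRing
      have := Ideal.Quotient.maximal_of_isField _
        (IsArtinianRing.isField_of_isDomain ((R ⧸ I) ⧸ q.asIdeal))
      exact PrimeSpectrum.ext (eq_maximalIdeal this)
  rw [isWeaklyRegular_map_algebraMap_iff] at hfiber
  have e : (R ⧸ I) ≃ₗ[R] R ⧸ I • (⊤ : Submodule R R) := Submodule.quotEquivOfEq _ _ (by simp)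
  obtain ⟨h₁, h₂⟩ :=
    Module.Flat.isWeaklyRegular_and_flat_quotient ((e.isWeaklyRegular_congr _).mp hfiber)
  refine ⟨(isRegular_iff_isWeaklyRegular_of_subset_maximalIdeal htm).mpr h₁, ?_⟩
  have e' : (R ⧸ Ideal.span (Set.range t)) ≃ₗ[R]
      R ⧸ Ideal.ofList (List.ofFn t) • (⊤ : Submodule R R) :=
    Submodule.quotEquivOfEq _ _ (by simp [hspan])
  exact .of_linearEquiv (e'.restrictScalars A)
end
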